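/- arXiv:1701.07634 — 5 statements merged into one kernel-verified Lean document; each statement's English description precedes it below -/
import Mathlib

section
/- Let (J, 𝓑) be a measurable space, θ a measure on (J, 𝓑), and let ν₁, ν₂ be probability measures on (J, 𝓑) admitting densities f₁, f₂ with respect to θ. Suppose there exist B ∈ 𝓑 with 0 < θ(B) < +∞ and β > 0 such that f₁(y) ≥ β and f₂(y) ≥ β for all y ∈ B. Then for every bounded measurable function g : J → ℝ one has |∫ g dν₁ − ∫ g dν₂| ≤ 2(1 − β·θ(B))·‖g‖_∞. -/
open MeasureTheory

theorem minorization_aux {J : Type*} [MeasurableSpace J]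
    (θ : Measure J) (f : J → ℝ) (hf : Measurable f) (hf0 : ∀ y, 0 ≤ f y)
    (ν : Measure J) (hν : ν = θ.withDensity (fun y => ENNReal.ofReal (f y)))
    [IsProbabilityMeasure ν]
    (B : Set J) (hB : MeasurableSet B) (hBfin : θ B < ⊤)
    (β : ℝ) (hlow : ∀ y ∈ B, β ≤ f y)
    (g : J → ℝ) (hg : Measurable g) (Cg : ℝ) (hCg : ∀ y, |g y| ≤ Cg) :
    |(∫ y, g y ∂ν) - ∫ y, B.indicator (fun _ => β) y * g y ∂θ|
      ≤ (1 - β * (θ B).toReal) * Cg := by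
  have h1 : ∫⁻ y, ENNReal.ofReal (f y) ∂θ = 1 := by
    have h := measure_univ (μ := ν)
    rw [hν, withDensity_apply _ MeasurableSet.univ, Measure.restrict_univ] at h
    exact h
  have hint : Integrable f θ := by
    refine ⟨hf.aestronglyMeasurable, ?_⟩
    rw [hasFiniteIntegral_iff_ofReal (Filter.Eventually.of_forall hf0), h1]
    exact ENNReal.one_lt_top
  have hf1 : ∫ y, f y ∂θ = 1 := by
    rw [integral_eq_lintegral_of_nonneg_ae (Filter.Eventually.of_forall hf0)
      hf.aestronglyMeasurable, h1]
    simp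
  have hind : Integrable (B.indicator (fun _ => β)) θ :=
    (integrable_indicator_iff hB).2 (integrableOn_const hBfin.ne)
  have hindI : ∫ y, B.indicator (fun _ => β) y ∂θ = β * (θ B).toReal := by
    rw [integral_indicator hB, setIntegral_const, smul_eq_mul, mul_comm]
    rfl
  have hbd : ∀ᵐ y ∂θ, ‖g y‖ ≤ Cg := Filter.Eventually.of_forall hCg
  have hg1 : ∫ y, g y ∂ν = ∫ y, f y * g y ∂θ := by
    rw [hν, integral_withDensity_eq_integral_toReal_smul hf.ennreal_ofReal
      (Filter.Eventually.of_forall fun _ => ENNReal.ofReal_lt_top)]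
    simp [ENNReal.toReal_ofReal, hf0]
  rw [hg1, ← integral_sub (hint.mul_bdd hg.aestronglyMeasurable hbd)
    (hind.mul_bdd hg.aestronglyMeasurable hbd), ← hf1, ← hindI, ← integral_sub hint hind,
    ← integral_mul_const, ← Real.norm_eq_abs]
  refine norm_integral_le_of_norm_le ((hint.sub hind).mul_const Cg)
    (Filter.Eventually.of_forall fun y => ?_)
  have hnn : 0 ≤ f y - B.indicator (fun _ => β) y := by
    by_cases hy : y ∈ B
    · simpa [hy] using hlow y hy
    · simpa [hy] using hf0 y
  rw [← sub_mul, norm_mul, Real.norm_of_nonneg hnn]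
  exact mul_le_mul_of_nonneg_left (hCg y) hnn

/-- Minorization implies contraction: if two probability measures `ν₁, ν₂` have densities
`f₁, f₂` with respect to `θ` which are bounded below by `β > 0` on a set `B` with
`0 < θ(B) < ∞`, then for every bounded measurable `g` (with `|g| ≤ Cg` pointwise) one has
`|∫ g dν₁ − ∫ g dν₂| ≤ 2(1 − β·θ(B))·Cg`. -/
theorem minorization_contraction {J : Type*} [MeasurableSpace J]
    (θ : Measure J) (f₁ f₂ : J → ℝ)
    (hf₁meas : Measurable f₁) (hf₂meas : Measurable f₂)
    (hf₁0 : ∀ y, 0 ≤ f₁ y) (hf₂0 : ∀ y, 0 ≤ f₂ y)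
    (ν₁ ν₂ : Measure J)
    (hν₁ : ν₁ = θ.withDensity (fun y => ENNReal.ofReal (f₁ y)))
    (hν₂ : ν₂ = θ.withDensity (fun y => ENNReal.ofReal (f₂ y)))
    [IsProbabilityMeasure ν₁] [IsProbabilityMeasure ν₂]
    (B : Set J) (hB : MeasurableSet B) (hB0 : 0 < θ B) (hBfin : θ B < ⊤)
    (β : ℝ) (hβ : 0 < β)
    (hlow₁ : ∀ y ∈ B, β ≤ f₁ y) (hlow₂ : ∀ y ∈ B, β ≤ f₂ y)
    (g : J → ℝ) (hg : Measurable g) (Cg : ℝ) (hCg : ∀ y, |g y| ≤ Cg) :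
    |(∫ y, g y ∂ν₁) - ∫ y, g y ∂ν₂| ≤ 2 * (1 - β * (θ B).toReal) * Cg := by
  have h1 := minorization_aux θ f₁ hf₁meas hf₁0 ν₁ hν₁ B hB hBfin β hlow₁ g hg Cg hCg
  have h2 := minorization_aux θ f₂ hf₂meas hf₂0 ν₂ hν₂ B hB hBfin β hlow₂ g hg Cg hCg
  rw [abs_le] at *
  constructor <;> linarith [h1.1, h1.2, h2.1, h2.2]
end

section
/- Let (J, 𝓑) be a measurable space and (κ_t)_{t≥0} a semigroup of Markov (probability) kernels on J, i.e. κ₀(x) = δ_x, each κ_t(x) is a probability measure, and κ_{s+t}(x)(A) = ∫ κ_t(y)(A) dκ_s(x)(y) for all s,t ≥ 0, x ∈ J, A ∈ 𝓑. Let μ be an invariant probability measure: ∫ κ_t(x)(A) dμ(x) = μ(A) for all t ≥ 0 and A ∈ 𝓑. Let V : J → [0,∞) be measurable with: (V1) there exists t₀ > 0 such that for every R > 0 there exists α_R ∈ (0,1) with |∫ f dκ_{t₀}(x) − ∫ f dκ_{t₀}(y)| ≤ 2(1−α_R)‖f‖_∞ for every bounded measurable f : J → ℝ and all x, y ∈ J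 with V(x)+V(y) ≤ R; (V2) there exist γ, K > 0 such that ∫ V dκ_t(x) ≤ e^{−γt}V(x) + K for all t ≥ 0 and x ∈ J. Then ∫ V dμ < +∞, every measurable g : J → ℝ with ‖g/(1+V)‖_∞ < +∞ is μ-integrable, and there exist constants C, α > 0 such that for all x ∈ J, t ≥ 0 and all such g: |∫ g dκ_t(x) − μ(g)| ≤ C·(1+V(x))·e^{−αt}·‖(g − μ(g))/(1+V)‖_∞. -/
open MeasureTheory Filter

namespace HarrisAux

lemma integral_of_comp {J : Type*} [MeasurableSpace J] (ν ρ : Measure J)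
    (η : J → Measure J) (hη : Measurable η)
    (h : ∀ A : Set J, MeasurableSet A → ρ A = ∫⁻ y, η y A ∂ν)
    (f : J → ℝ) (hf : Integrable f ρ) : ∫ z, f z ∂ρ = ∫ y, ∫ z, f z ∂(η y) ∂ν := by
  let k : ProbabilityTheory.Kernel J J := ⟨η, hη⟩
  let c : ProbabilityTheory.Kernel Unit J := ProbabilityTheory.Kernel.const Unit ν
  have e : (k.comp c) () = ρ := by
    ext A hA
    rw [ProbabilityTheory.Kernel.comp_apply' _ _ _ hA, h A hA]
    rfl
  have := ProbabilityTheory.Kernel.integral_comp (κ := c) (η := k) (a := ()) (f := f) (by rwa [e])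
  rw [e] at this
  exact this

lemma lintegral_of_comp {J : Type*} [MeasurableSpace J] (ν ρ : Measure J)
    (η : J → Measure J) (hη : Measurable η)
    (h : ∀ A : Set J, MeasurableSet A → ρ A = ∫⁻ y, η y A ∂ν)
    (f : J → ENNReal) (hf : Measurable f) : ∫⁻ z, f z ∂ρ = ∫⁻ y, ∫⁻ z, f z ∂(η y) ∂ν := by
  have e : ρ = ν.bind η := by
    ext A hA
    rw [Measure.bind_apply hA hη.aemeasurable, h A hA]
  rw [e, Measure.lintegral_bind hη.aemeasurable hf.aemeasurable]

lemma measurable_integral {J : Type*} [MeasurableSpace J]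
    (η : J → Measure J) (hη : Measurable η) (hp : ∀ x, IsProbabilityMeasure (η x))
    (f : J → ℝ) (hf : Measurable f) : Measurable (fun x => ∫ y, f y ∂(η x)) := by
  let k : ProbabilityTheory.Kernel J J := ⟨η, hη⟩
  have : ProbabilityTheory.IsMarkovKernel k := ⟨hp⟩
  exact (StronglyMeasurable.integral_kernel (κ := k) hf.stronglyMeasurable).measurable

lemma integ {J : Type*} [MeasurableSpace J] (ν : Measure J) [IsProbabilityMeasure ν]
    (V : J → ℝ) (hV : Integrable V ν) (g : J → ℝ) (hg : Measurable g) (A B : ℝ)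
    (h : ∀ x, |g x| ≤ A + B * V x) : Integrable g ν := by
  refine Integrable.mono' ((integrable_const A).add (hV.const_mul B)) hg.aestronglyMeasurable ?_
  exact Eventually.of_forall fun x => by simpa using h x

lemma integ_bound {J : Type*} [MeasurableSpace J] (ν : Measure J) [IsProbabilityMeasure ν]
    (V : J → ℝ) (hV : Integrable V ν) (g : J → ℝ) (A B : ℝ)
    (h : ∀ x, |g x| ≤ A + B * V x) : |∫ x, g x ∂ν| ≤ A + B * ∫ x, V x ∂ν := by
  have h1 := norm_integral_le_of_norm_le (f := g) (μ := ν)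
    ((integrable_const A).add (hV.const_mul B)) (Eventually.of_forall fun x => by simpa using h x)
  simp only [Pi.add_apply] at h1
  rw [integral_add (integrable_const A) (hV.const_mul B), integral_const_mul] at h1
  simpa using h1

lemma V_fin {J : Type*} [MeasurableSpace J] (μ : Measure J) [IsProbabilityMeasure μ]
    (κ : ℕ → J → Measure J) (hκ : ∀ n, Measurable (κ n))
    (hp : ∀ n x, IsProbabilityMeasure (κ n x))
    (hinv : ∀ n, ∀ A : Set J, MeasurableSet A → μ A = ∫⁻ x, κ n x A ∂μ)
    (V : J → ℝ) (hVmeas : Measurable V) (e : ℕ → ℝ)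
    (he : Tendsto e atTop (nhds 0)) (K : ℝ)
    (hV2 : ∀ n x, (∫⁻ y, ENNReal.ofReal (V y) ∂(κ n x)) ≤ ENNReal.ofReal (e n * V x + K)) :
    (∫⁻ x, ENNReal.ofReal (V x) ∂μ) ≤ ENNReal.ofReal K := by
  have hm : Measurable (fun x => ENNReal.ofReal (V x)) := hVmeas.ennreal_ofReal
  have key : ∀ N : ℕ, ∫⁻ x, min (ENNReal.ofReal (V x)) N ∂μ ≤ ENNReal.ofReal K := by
    intro N
    have h1 : ∀ n, ∫⁻ x, min (ENNReal.ofReal (V x)) N ∂μ ≤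
        ∫⁻ x, min (ENNReal.ofReal (e n * V x + K)) N ∂μ := by
      intro n
      rw [lintegral_of_comp μ μ (κ n) (hκ n) (hinv n) _ (hm.min measurable_const)]
      refine lintegral_mono fun x => ?_
      have := hp n x
      refine le_min ((lintegral_mono fun y => min_le_left _ _).trans (hV2 n x)) ?_
      refine (lintegral_mono fun y => min_le_right _ _).trans ?_
      simp
    have h2 : Tendsto (fun n => ∫⁻ x, min (ENNReal.ofReal (e n * V x + K)) N ∂μ) atTop
        (nhds (∫⁻ x, min (ENNReal.ofReal (0 * V x + K)) N ∂μ)) := by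
      refine tendsto_lintegral_of_dominated_convergence (fun _ => (N : ENNReal)) ?_ ?_ ?_ ?_
      · intro n
        exact (((hVmeas.const_mul _).add_const _).ennreal_ofReal).min measurable_const
      · intro n
        exact Eventually.of_forall fun x => min_le_right _ _
      · simp
      · refine Eventually.of_forall fun x => ?_
        refine Tendsto.min ?_ tendsto_const_nhds
        exact ENNReal.tendsto_ofReal ((he.mul_const _).add_const _)
    refine (ge_of_tendsto' h2 h1).trans ?_
    refine (lintegral_mono fun y => min_le_left _ _).trans ?_
    simp
  have h3 : ∀ x, ENNReal.ofReal (V x) = ⨆ N : ℕ, min (ENNReal.ofReal (V x)) N := by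
    intro x
    refine le_antisymm ?_ (iSup_le fun N => min_le_left _ _)
    obtain ⟨N, hN⟩ := ENNReal.exists_nat_gt (ENNReal.ofReal_ne_top (r := V x))
    exact le_iSup_of_le N (le_min le_rfl hN.le)
  rw [lintegral_congr h3]
  rw [lintegral_iSup (fun N => hm.min measurable_const)]
  · exact iSup_le key
  · intro a b hab x
    exact min_le_min le_rfl (by exact_mod_cast hab)

lemma contraction {J : Type*} [MeasurableSpace J] [Nonempty J] (P : J → Measure J)
    (hp : ∀ x, IsProbabilityMeasure (P x))
    (V : J → ℝ) (hVmeas : Measurable V) (hV0 : ∀ x, 0 ≤ V x)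
    (hVi : ∀ x, Integrable V (P x)) (η K : ℝ) (hη0 : 0 < η) (hη1 : η < 1) (hK : 0 < K)
    (hdrift : ∀ x, ∫ y, V y ∂(P x) ≤ η * V x + K)
    (hV1 : ∀ R > (0:ℝ), ∃ α ∈ Set.Ioo (0:ℝ) 1,
      ∀ f : J → ℝ, Measurable f → ∀ Cf : ℝ, (∀ z, |f z| ≤ Cf) →
      ∀ x y : J, V x + V y ≤ R →
        |(∫ z, f z ∂(P x)) - ∫ z, f z ∂(P y)| ≤ 2 * (1 - α) * Cf) :
    ∃ β, 0 < β ∧ β ≤ 1 ∧ ∃ a, 0 < a ∧ a < 1 ∧ ∀ g : J → ℝ, Measurable g →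
      ∀ M, 0 ≤ M → (∀ x y, |g x - g y| ≤ M * (2 + β * V x + β * V y)) →
      ∀ x y, |(∫ z, g z ∂(P x)) - ∫ z, g z ∂(P y)| ≤ a * M * (2 + β * V x + β * V y) := by
  have h1η : 0 < 1 - η := by linarith
  set R := 4 * K / (1 - η) with hR
  have hRpos : 0 < R := by positivity
  have hRK : R * (1 - η) = 4 * K := by rw [hR]; field_simp
  obtain ⟨α, ⟨hα0, hα1⟩, hα⟩ := hV1 R hRpos
  set β := min 1 (α / (2 * K)) with hβ
  have hβ0 : 0 < β := lt_min one_pos (by positivity)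
  have hβ1 : β ≤ 1 := min_le_left _ _
  have hβK : 2 * β * K ≤ α := by
    have : β ≤ α / (2 * K) := min_le_right _ _
    rw [le_div_iff₀ (by positivity)] at this
    linarith
  set δ := min (β * R * (1 - η) / (2 * (2 + β * R))) (min (α / 2) (1 - η)) with hδ
  have hδ0 : 0 < δ := lt_min (by positivity) (lt_min (by positivity) h1η)
  have hδ1 : δ * (2 * (2 + β * R)) ≤ β * R * (1 - η) := by
    rw [← le_div_iff₀ (by positivity)]; exact min_le_left _ _
  have hδ2 : δ ≤ α / 2 := (min_le_right _ _).trans (min_le_left _ _)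
  have hδ3 : δ ≤ 1 - η := (min_le_right _ _).trans (min_le_right _ _)
  have hδ4 : δ ≤ (1 - η) / 2 := by
    by_contra hcon
    push Not at hcon
    have : 0 < β * R := by positivity
    nlinarith
  refine ⟨β, hβ0, hβ1, 1 - δ, by linarith, by linarith, ?_⟩
  intro g hg M hM hosc x y
  -- shift
  obtain ⟨c, hc⟩ : ∃ c, ∀ z, |g z - c| ≤ M + (M * β) * V z := by
    have hub : ∀ z w, g z - (M + (M * β) * V z) ≤ g w + (M + (M * β) * V w) := by
      intro z w
      have := (abs_le.1 (hosc z w)).2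
      linarith
    refine ⟨⨆ z, (g z - (M + (M * β) * V z)), fun z => ?_⟩
    have a1 : g z - (M + (M * β) * V z) ≤ ⨆ z, (g z - (M + (M * β) * V z)) :=
      le_ciSup (f := fun z => g z - (M + (M * β) * V z))
        ⟨g z + (M + (M * β) * V z), by rintro _ ⟨w, rfl⟩; exact hub w z⟩ z
    have a2 : (⨆ z, (g z - (M + (M * β) * V z))) ≤ g z + (M + (M * β) * V z) :=
      ciSup_le fun w => hub w z
    rw [abs_le]; constructor <;> linarith
  have hS := add_nonneg (hV0 x) (hV0 y)
  have hMβ : 0 ≤ M * β := by positivity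
  have hgc : Measurable (fun z => g z - c) := hg.sub_const c
  have hint : ∀ w, Integrable (fun z => g z - c) (P w) := fun w => by
    have := hp w
    exact integ (P w) V (hVi w) _ hgc _ _ hc
  have hgi : ∀ w, ∫ z, g z ∂(P w) = (∫ z, (g z - c) ∂(P w)) + c := fun w => by
    have := hp w
    have : Integrable g (P w) := by
      have := (hint w).add (integrable_const c)
      refine this.congr (Eventually.of_forall fun z => by simp)
    rw [integral_sub this (integrable_const c)]; simp
  rw [hgi x, hgi y, add_sub_add_right_eq_sub]
  by_cases hcase : V x + V y ≤ R
  · set f : J → ℝ := fun z => max (-M) (min M (g z - c)) with hf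
    have hfm : Measurable f := measurable_const.max (measurable_const.min hgc)
    have hfb : ∀ z, |f z| ≤ M := fun z => by
      rw [abs_le]
      exact ⟨le_max_left _ _, max_le (by linarith) (min_le_left _ _)⟩
    have hfi : ∀ w, Integrable f (P w) := fun w => by
      have := hp w
      exact integ (P w) V (hVi w) _ hfm M 0 (fun z => by simpa using hfb z)
    have hrest : ∀ z, |(g z - c) - f z| ≤ 0 + (M * β) * V z := fun z => by
      have h1 := abs_le.1 (hc z)
      have h2 : 0 ≤ (M * β) * V z := mul_nonneg hMβ (hV0 z)
      simp only [hf]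
      rw [abs_le]
      rcases le_total M (g z - c) with h | h
      · rw [min_eq_left h, max_eq_right (by linarith)]
        constructor <;> linarith
      · rw [min_eq_right h]
        rcases le_total (-M) (g z - c) with h' | h'
        · rw [max_eq_right h']; constructor <;> linarith
        · rw [max_eq_left h']; constructor <;> linarith
    have hr : ∀ w, |∫ z, ((g z - c) - f z) ∂(P w)| ≤ (M * β) * (η * V w + K) := fun w => by
      have := hp w
      have := integ_bound (P w) V (hVi w) _ _ _ hrest
      have := mul_le_mul_of_nonneg_left (hdrift w) hMβ
      linarith
    have hsplit : ∀ w, ∫ z, (g z - c) ∂(P w) =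
        ∫ z, ((g z - c) - f z) ∂(P w) + ∫ z, f z ∂(P w) := fun w => by
      rw [integral_sub (hint w) (hfi w)]; ring
    rw [hsplit x, hsplit y]
    have b1 := abs_le.1 (hα f hfm M hfb x y hcase)
    have b2 := abs_le.1 (hr x)
    have b3 := abs_le.1 (hr y)
    have fin : 2 * (1 - α) * M + (M * β) * (η * V x + K) + (M * β) * (η * V y + K)
        ≤ (1 - δ) * M * (2 + β * V x + β * V y) := by
      have : 2 * (1 - α) + β * (η * (V x + V y)) + 2 * β * K ≤
          (1 - δ) * (2 + β * (V x + V y)) := by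
        have : β * (V x + V y) * η ≤ β * (V x + V y) * (1 - δ) :=
          mul_le_mul_of_nonneg_left (by linarith) (by positivity)
        linarith
      have := mul_le_mul_of_nonneg_left this hM
      linarith
    rw [abs_le]; constructor <;> linarith
  · push Not at hcase
    have hr : ∀ w, |∫ z, (g z - c) ∂(P w)| ≤ M + (M * β) * (η * V w + K) := fun w => by
      have := hp w
      have := integ_bound (P w) V (hVi w) _ _ _ hc
      have := mul_le_mul_of_nonneg_left (hdrift w) hMβ
      linarith
    have b2 := abs_le.1 (hr x)
    have b3 := abs_le.1 (hr y)
    have fin : 2 * M + (M * β) * (η * V x + K) + (M * β) * (η * V y + K)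
        ≤ (1 - δ) * M * (2 + β * V x + β * V y) := by
      have : 2 + β * (η * (V x + V y)) + 2 * β * K ≤
          (1 - δ) * (2 + β * (V x + V y)) := by
        have e1 : 2 * β * K = β * (R * (1 - η)) / 2 := by rw [hRK]; ring
        have e2 : β * ((1 - η) / 2 - δ) * R ≤ β * ((1 - η) / 2 - δ) * (V x + V y) :=
          mul_le_mul_of_nonneg_left hcase.le (mul_nonneg hβ0.le (by linarith))
        have e3 : β * (1 - η) * R ≤ β * (1 - η) * (V x + V y) :=
          mul_le_mul_of_nonneg_left hcase.le (by positivity)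
        linarith
      have := mul_le_mul_of_nonneg_left this hM
      linarith
    rw [abs_le]; constructor <;> linarith

end HarrisAux

/-- Harris-type geometric ergodicity: if a Markov transition semigroup `κ` admits an
invariant probability measure `μ` and a (geometric) Lyapunov functional `V` satisfying the
small-set contraction condition (V1) and the drift condition (V2), then `∫ V dμ < ∞`,
every measurable `g` with `‖g/(1+V)‖_∞ < ∞` is `μ`-integrable, and there are constants
`C, α > 0` such that `|∫ g dκ_t(x) − μ(g)| ≤ C(1+V(x))e^{−αt}·‖(g−μ(g))/(1+V)‖_∞`
for all `x` and `t ≥ 0`. -/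
theorem harris_geometric_ergodicity {J : Type*} [MeasurableSpace J]
    (κ : ℝ → J → Measure J)
    (hker : ∀ t ≥ (0:ℝ), ∀ A : Set J, MeasurableSet A → Measurable (fun x => κ t x A))
    (hmarkov : ∀ t ≥ (0:ℝ), ∀ x, IsProbabilityMeasure (κ t x))
    (h0 : ∀ x, κ 0 x = Measure.dirac x)
    (hsemigroup : ∀ s ≥ (0:ℝ), ∀ t ≥ (0:ℝ), ∀ x, ∀ A : Set J, MeasurableSet A →
      κ (s + t) x A = ∫⁻ y, κ t y A ∂(κ s x))
    (μ : Measure J) [IsProbabilityMeasure μ]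
    (hinv : ∀ t ≥ (0:ℝ), ∀ A : Set J, MeasurableSet A → (∫⁻ x, κ t x A ∂μ) = μ A)
    (V : J → ℝ) (hVmeas : Measurable V) (hV0 : ∀ x, 0 ≤ V x)
    -- (V1): small-set contraction at some time t₀ > 0, on sublevel sets of V
    (hV1 : ∃ t₀ > (0:ℝ), ∀ R > (0:ℝ), ∃ α ∈ Set.Ioo (0:ℝ) 1,
      ∀ f : J → ℝ, Measurable f → ∀ Cf : ℝ, (∀ z, |f z| ≤ Cf) →
      ∀ x y : J, V x + V y ≤ R →
        |(∫ z, f z ∂(κ t₀ x)) - ∫ z, f z ∂(κ t₀ y)| ≤ 2 * (1 - α) * Cf)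
    -- (V2): geometric drift condition
    (hV2 : ∃ γ > (0:ℝ), ∃ K > (0:ℝ), ∀ t ≥ (0:ℝ), ∀ x,
      (∫⁻ y, ENNReal.ofReal (V y) ∂(κ t x)) ≤
        ENNReal.ofReal (Real.exp (-γ * t) * V x + K)) :
    (∫⁻ x, ENNReal.ofReal (V x) ∂μ) < ⊤ ∧
    (∀ g : J → ℝ, Measurable g → ∀ Cg : ℝ, (∀ x, |g x| ≤ Cg * (1 + V x)) →
      Integrable g μ) ∧
    ∃ C > (0:ℝ), ∃ α > (0:ℝ), ∀ g : J → ℝ, Measurable g →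
      ∀ Cg : ℝ, (∀ x, |g x| ≤ Cg * (1 + V x)) →
      ∀ C' : ℝ, (∀ x, |g x - ∫ y, g y ∂μ| ≤ C' * (1 + V x)) →
      ∀ x : J, ∀ t ≥ (0:ℝ),
        |(∫ y, g y ∂(κ t x)) - ∫ y, g y ∂μ| ≤
          C * (1 + V x) * Real.exp (-α * t) * C' := by
  obtain ⟨t₀, ht₀, hV1⟩ := hV1
  obtain ⟨γ, hγ, K, hK, hV2⟩ := hV2
  have hmk : ∀ t ≥ (0:ℝ), Measurable (κ t) := fun t ht =>
    Measure.measurable_of_measurable_coe _ (hker t ht)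
  have hfin : (∫⁻ x, ENNReal.ofReal (V x) ∂μ) < ⊤ := by
    refine lt_of_le_of_lt (HarrisAux.V_fin μ (fun n : ℕ => κ n)
      (fun n => hmk n n.cast_nonneg) (fun n x => hmarkov n n.cast_nonneg x)
      (fun n A hA => (hinv n n.cast_nonneg A hA).symm) V hVmeas
      (fun n : ℕ => Real.exp (-γ * n)) ?_ K (fun n x => hV2 n n.cast_nonneg x)) ENNReal.ofReal_lt_top
    refine Real.tendsto_exp_atBot.comp ?_
    exact tendsto_natCast_atTop_atTop.const_mul_atTop_of_neg (by linarith)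
  have hVint : ∀ ν : Measure J, (∫⁻ x, ENNReal.ofReal (V x) ∂ν) < ⊤ → Integrable V ν := by
    intro ν h
    refine ⟨hVmeas.aestronglyMeasurable, ?_⟩
    rw [hasFiniteIntegral_iff_ofReal (Eventually.of_forall hV0)]
    exact h
  have hVμ := hVint μ hfin
  have hVκ : ∀ t ≥ (0:ℝ), ∀ x, Integrable V (κ t x) := fun t ht x =>
    hVint _ ((hV2 t ht x).trans_lt ENNReal.ofReal_lt_top)
  have hdrift : ∀ t ≥ (0:ℝ), ∀ x, ∫ y, V y ∂(κ t x) ≤ Real.exp (-γ * t) * V x + K := by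
    intro t ht x
    have h1 := hV2 t ht x
    rw [← ofReal_integral_eq_lintegral_ofReal (hVκ t ht x) (Eventually.of_forall hV0)] at h1
    refine (ENNReal.ofReal_le_ofReal_iff ?_).1 h1
    have := hV0 x
    positivity
  have hdrift' : ∀ t ≥ (0:ℝ), ∀ x, ∫ y, V y ∂(κ t x) ≤ V x + K := by
    intro t ht x
    have h1 : Real.exp (-γ * t) ≤ 1 := by
      rw [Real.exp_le_one_iff]; nlinarith
    have := mul_le_mul_of_nonneg_right h1 (hV0 x)
    linarith [hdrift t ht x]
  have hgμ : ∀ g : J → ℝ, Measurable g → ∀ Cg : ℝ, (∀ x, |g x| ≤ Cg * (1 + V x)) →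
      Integrable g μ := fun g hg Cg h =>
    HarrisAux.integ μ V hVμ g hg Cg Cg (fun x => by linarith [h x])
  refine ⟨hfin, hgμ, ?_⟩
  have : Nonempty J := nonempty_of_isProbabilityMeasure μ
  have hη1 : Real.exp (-γ * t₀) < 1 := by
    rw [Real.exp_lt_one_iff]; nlinarith
  obtain ⟨β, hβ0, hβ1, a, ha0, ha1, hcon⟩ := HarrisAux.contraction (κ t₀)
    (hmarkov t₀ ht₀.le) V hVmeas hV0 (hVκ t₀ ht₀.le) (Real.exp (-γ * t₀)) K (Real.exp_pos _)
    hη1 hK (hdrift t₀ ht₀.le) hV1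
  -- bounded functions stay bounded
  have hbd : ∀ h : J → ℝ, ∀ A, 0 ≤ A → (∀ x, |h x| ≤ A * (1 + V x)) → ∀ t ≥ (0:ℝ), ∀ x,
      |∫ y, h y ∂(κ t x)| ≤ A * (1 + K) * (1 + V x) := by
    intro h A hA hh t ht x
    have := hmarkov t ht x
    have h1 := HarrisAux.integ_bound (κ t x) V (hVκ t ht x) h A A (fun x => by linarith [hh x])
    have h2 := mul_le_mul_of_nonneg_left (hdrift' t ht x) hA
    have h3 : 0 ≤ A * (K * V x) := mul_nonneg hA (mul_nonneg hK.le (hV0 x))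
    linarith
  have hinteg : ∀ h : J → ℝ, Measurable h → ∀ A, (∀ x, |h x| ≤ A * (1 + V x)) →
      ∀ t ≥ (0:ℝ), ∀ x, Integrable h (κ t x) := by
    intro h hm A hh t ht x
    have := hmarkov t ht x
    exact HarrisAux.integ (κ t x) V (hVκ t ht x) h hm A A (fun x => by linarith [hh x])
  have hmeasI : ∀ h : J → ℝ, Measurable h → ∀ t ≥ (0:ℝ),
      Measurable (fun x => ∫ y, h y ∂(κ t x)) := fun h hm t ht =>
    HarrisAux.measurable_integral (κ t) (hmk t ht) (hmarkov t ht) h hm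
  have hsg : ∀ h : J → ℝ, Measurable h → ∀ A, (∀ x, |h x| ≤ A * (1 + V x)) →
      ∀ s ≥ (0:ℝ), ∀ t ≥ (0:ℝ), ∀ x,
      ∫ z, h z ∂(κ (s + t) x) = ∫ y, ∫ z, h z ∂(κ t y) ∂(κ s x) := by
    intro h hm A hh s hs t ht x
    exact HarrisAux.integral_of_comp (κ s x) (κ (s + t) x) (κ t) (hmk t ht)
      (hsemigroup s hs t ht x) h (hinteg h hm A hh (s + t) (add_nonneg hs ht) x)
  have hiter : ∀ h : J → ℝ, Measurable h → ∀ A, 0 ≤ A → (∀ x, |h x| ≤ A * (1 + V x)) →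
      ∀ M, 0 ≤ M → (∀ x y, |h x - h y| ≤ M * (2 + β * V x + β * V y)) →
      ∀ n : ℕ, ∀ x y, |(∫ z, h z ∂(κ (n * t₀) x)) - ∫ z, h z ∂(κ (n * t₀) y)| ≤
        a ^ n * M * (2 + β * V x + β * V y) := by
    intro h hm A hA hh M hM hosc n
    induction n with
    | zero =>
      intro x y
      simp only [Nat.cast_zero, zero_mul, h0, pow_zero, one_mul]
      rw [integral_dirac' _ _ hm.stronglyMeasurable, integral_dirac' _ _ hm.stronglyMeasurable]
      exact hosc x y
    | succ n ih =>
      intro x y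
      have hn : (0:ℝ) ≤ n * t₀ := by positivity
      have e : ((n + 1 : ℕ) : ℝ) * t₀ = t₀ + n * t₀ := by push_cast; ring
      rw [e, hsg h hm A hh t₀ ht₀.le _ hn x, hsg h hm A hh t₀ ht₀.le _ hn y]
      have := hcon _ (hmeasI h hm _ hn) (a ^ n * M) (by positivity) ih x y
      rw [pow_succ]
      linarith
  set m := ∫ x, V x ∂μ with hmdef
  have hm0 : 0 ≤ m := integral_nonneg hV0
  -- convergence along the skeleton
  have hconv : ∀ h : J → ℝ, Measurable h → ∀ A, 0 ≤ A → (∀ x, |h x| ≤ A * (1 + V x)) →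
      ∫ x, h x ∂μ = 0 → ∀ n : ℕ, ∀ x,
      |∫ z, h z ∂(κ (n * t₀) x)| ≤ a ^ n * (A / β) * (2 + m) * (1 + V x) := by
    intro h hm A hA hh hμ0 n x
    have hn : (0:ℝ) ≤ n * t₀ := by positivity
    have hAβ : 0 ≤ A / β := by positivity
    have hw : ∀ z, A * (1 + V z) ≤ (A / β) * (1 + β * V z) := by
      intro z
      have : (A / β) * (1 + β * V z) = A / β + A * V z := by field_simp
      rw [this]
      have : A ≤ A / β := by
        rw [le_div_iff₀ hβ0]; nlinarith
      linarith
    have hosc : ∀ x y, |h x - h y| ≤ (A / β) * (2 + β * V x + β * V y) := by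
      intro x y
      have h1 := abs_sub (h x) (h y)
      linarith [hh x, hh y, hw x, hw y]
    have hit := hiter h hm A hA hh _ hAβ hosc n x
    set F := fun y => ∫ z, h z ∂(κ (n * t₀) y) with hF
    have hFm : Measurable F := hmeasI h hm _ hn
    have hFi : Integrable F μ := hgμ F hFm _ (hbd h A hA hh _ hn)
    have hF0 : ∫ y, F y ∂μ = 0 := by
      rw [← hμ0]
      exact (HarrisAux.integral_of_comp μ μ (κ (n * t₀)) (hmk _ hn)
        (fun B hB => (hinv _ hn B hB).symm) h (hgμ h hm A hh)).symm
    set q := a ^ n * (A / β) with hq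
    have hq0 : 0 ≤ q := by positivity
    have hb := HarrisAux.integ_bound μ V hVμ (fun y => F x - F y)
      (q * (2 + β * V x)) (q * β) (fun y => by
        have := hit y
        linarith)
    rw [integral_sub (integrable_const _) hFi, hF0] at hb
    simp only [integral_const, probReal_univ, one_smul, sub_zero] at hb
    refine hb.trans ?_
    have k1 : β * V x ≤ V x := mul_le_of_le_one_left (hV0 x) hβ1
    have k2 : β * m ≤ m := mul_le_of_le_one_left hm0 hβ1
    have k3 : 0 ≤ m * V x := mul_nonneg hm0 (hV0 x)
    have k4 : 2 + β * V x + β * m ≤ (2 + m) * (1 + V x) := by linarith [hV0 x]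
    have := mul_le_mul_of_nonneg_left k4 hq0
    linarith
  refine ⟨(1 + K) / β * (2 + m) / a, by positivity, -Real.log a / t₀,
    div_pos (neg_pos.2 (Real.log_neg ha0 ha1)) ht₀, ?_⟩
  intro g hg Cg hCg C' hC' x t ht
  have hC'0 : 0 ≤ C' := by
    have h1 := (abs_nonneg _).trans (hC' x)
    have h2 : 0 < 1 + V x := by linarith [hV0 x]
    exact nonneg_of_mul_nonneg_left h1 h2
  set c := ∫ y, g y ∂μ with hc
  have hgi := hgμ g hg Cg hCg
  set h : J → ℝ := fun y => g y - c with hh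
  have hhm : Measurable h := hg.sub_const c
  have hh0 : ∫ y, h y ∂μ = 0 := by
    simp only [hh]
    rw [integral_sub hgi (integrable_const c)]
    simp [hc]
  have hgh : (∫ y, g y ∂(κ t x)) - c = ∫ y, h y ∂(κ t x) := by
    have := hmarkov t ht x
    simp only [hh]
    rw [integral_sub (hinteg g hg Cg hCg t ht x) (integrable_const c)]
    simp
  rw [hgh]
  set n := ⌊t / t₀⌋₊ with hn
  have htt : 0 ≤ t / t₀ := by positivity
  have hn1 : (n : ℝ) * t₀ ≤ t := by
    rw [← le_div_iff₀ ht₀]; exact Nat.floor_le htt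
  have hn2 : t / t₀ < n + 1 := Nat.lt_floor_add_one _
  have hnn : (0:ℝ) ≤ n * t₀ := by positivity
  have hs : 0 ≤ t - n * t₀ := by linarith
  have e := hsg h hhm C' hC' (n * t₀) hnn (t - n * t₀) hs x
  rw [add_sub_cancel] at e
  rw [e]
  have hu0 : ∫ y, (∫ z, h z ∂(κ (t - n * t₀) y)) ∂μ = 0 := by
    rw [← hh0]
    exact (HarrisAux.integral_of_comp μ μ (κ (t - n * t₀)) (hmk _ hs)
      (fun B hB => (hinv _ hs B hB).symm) h (hgμ h hhm C' hC')).symm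
  have hfinal := hconv _ (hmeasI h hhm _ hs) (C' * (1 + K)) (by positivity)
    (hbd h C' hC'0 hC' _ hs) hu0 n x
  refine hfinal.trans ?_
  have hexp : a ^ n ≤ Real.exp (-(-Real.log a / t₀) * t) / a := by
    rw [le_div_iff₀ ha0, ← pow_succ, ← Real.rpow_natCast, Real.rpow_def_of_pos ha0,
      Real.exp_le_exp]
    have e1 : -(-Real.log a / t₀) * t = Real.log a * (t / t₀) := by ring
    rw [e1]
    push_cast
    exact mul_le_mul_of_nonpos_left hn2.le (Real.log_neg ha0 ha1).le
  have hrest : 0 ≤ (C' * (1 + K) / β) * (2 + m) * (1 + V x) := by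
    have := hV0 x
    positivity
  have := mul_le_mul_of_nonneg_right hexp hrest
  calc a ^ n * (C' * (1 + K) / β) * (2 + m) * (1 + V x)
      = a ^ n * ((C' * (1 + K) / β) * (2 + m) * (1 + V x)) := by ring
    _ ≤ _ := this
    _ = _ := by ring
end

section
/- For every x > 0 and a > 0 one has the two-sided bound (2x/√(2πa))·e^{−x²/(2a)} ≤ ∫_a^∞ (x/√(2πs³))·e^{−x²/(2s)} ds ≤ 2x/√(2πa), and in particular the improper integral is finite. -/
open MeasureTheory

/-- Two-sided bound for the tail of the Brownian first-passage density: for `x, a > 0`,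
`(2x/√(2πa))·e^{−x²/(2a)} ≤ ∫_a^∞ (x/√(2πs³))·e^{−x²/(2s)} ds ≤ 2x/√(2πa)`;
in particular the improper integral is finite. -/
theorem first_passage_tail_bounds (x a : ℝ) (hx : 0 < x) (ha : 0 < a) :
    IntegrableOn (fun s => x / Real.sqrt (2 * Real.pi * s ^ 3) *
        Real.exp (-x ^ 2 / (2 * s))) (Set.Ioi a) volume ∧
    2 * x / Real.sqrt (2 * Real.pi * a) * Real.exp (-x ^ 2 / (2 * a)) ≤
      (∫ s in Set.Ioi a, x / Real.sqrt (2 * Real.pi * s ^ 3) *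
        Real.exp (-x ^ 2 / (2 * s))) ∧
    (∫ s in Set.Ioi a, x / Real.sqrt (2 * Real.pi * s ^ 3) *
        Real.exp (-x ^ 2 / (2 * s))) ≤ 2 * x / Real.sqrt (2 * Real.pi * a) := by
  have hpi : 0 < 2 * Real.pi := by positivity
  have hg : ∀ s ∈ Set.Ioi a, x / Real.sqrt (2 * Real.pi * s ^ 3) =
      x / Real.sqrt (2 * Real.pi) * s ^ (-(3 / 2) : ℝ) := by
    intro s hs
    have hs0 : 0 < s := ha.trans hs
    have h3 : Real.sqrt (s ^ 3) = s ^ (3 / 2 : ℝ) := by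
      rw [Real.sqrt_eq_rpow, ← Real.rpow_natCast, ← Real.rpow_mul hs0.le]
      norm_num
    rw [Real.sqrt_mul hpi.le, h3, Real.rpow_neg hs0.le, ← div_div, div_eq_mul_inv _ (s ^ _)]
  have hgi : IntegrableOn (fun s => x / Real.sqrt (2 * Real.pi * s ^ 3)) (Set.Ioi a) volume := by
    rw [integrableOn_congr_fun hg measurableSet_Ioi]
    exact (integrableOn_Ioi_rpow_of_lt (by norm_num) ha).const_mul _
  have hgI : ∫ s in Set.Ioi a, x / Real.sqrt (2 * Real.pi * s ^ 3) =
      2 * x / Real.sqrt (2 * Real.pi * a) := by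
    rw [setIntegral_congr_fun measurableSet_Ioi hg, integral_const_mul,
      integral_Ioi_rpow_of_lt (by norm_num) ha, Real.sqrt_mul hpi.le, Real.sqrt_eq_rpow a,
      show (-(3 / 2) + 1 : ℝ) = -(1 / 2) by norm_num, Real.rpow_neg ha.le]
    have := Real.rpow_pos_of_pos ha (1 / 2)
    field_simp
  have hnn : ∀ s : ℝ, 0 ≤ x / Real.sqrt (2 * Real.pi * s ^ 3) := fun s => by positivity
  have hle : ∀ s ∈ Set.Ioi a, x / Real.sqrt (2 * Real.pi * s ^ 3) *
      Real.exp (-x ^ 2 / (2 * s)) ≤ x / Real.sqrt (2 * Real.pi * s ^ 3) := by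
    intro s hs
    have hs0 : 0 < s := ha.trans hs
    refine mul_le_of_le_one_right (hnn s) (Real.exp_le_one_iff.2 ?_)
    rw [neg_div]
    have : 0 ≤ x ^ 2 / (2 * s) := by positivity
    linarith
  have hge : ∀ s ∈ Set.Ioi a, x / Real.sqrt (2 * Real.pi * s ^ 3) *
      Real.exp (-x ^ 2 / (2 * a)) ≤ x / Real.sqrt (2 * Real.pi * s ^ 3) *
      Real.exp (-x ^ 2 / (2 * s)) := by
    intro s hs
    have hs' : a ≤ s := le_of_lt hs
    refine mul_le_mul_of_nonneg_left (Real.exp_le_exp.2 ?_) (hnn s)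
    rw [neg_div, neg_div, neg_le_neg_iff]
    gcongr
  have hfi : IntegrableOn (fun s => x / Real.sqrt (2 * Real.pi * s ^ 3) *
        Real.exp (-x ^ 2 / (2 * s))) (Set.Ioi a) volume := by
    refine Integrable.mono' hgi (Measurable.aestronglyMeasurable (by fun_prop)) ?_
    filter_upwards [ae_restrict_mem measurableSet_Ioi] with s hs
    rw [Real.norm_of_nonneg (mul_nonneg (hnn s) (Real.exp_pos _).le)]
    exact hle s hs
  refine ⟨hfi, ?_, ?_⟩
  · rw [← hgI, ← integral_mul_const]
    exact setIntegral_mono_on (hgi.mul_const _) hfi measurableSet_Ioi hge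
  · rw [← hgI]
    exact setIntegral_mono_on hfi hgi measurableSet_Ioi hle
end

section
/- Fix λ > 0 and for t > 0 set τ(t) := (e^{2λt} − 1)/(2λ). Then for every x > 0 and t > 0 one has √(4λ/π)·x·e^{−λt}·e^{−x²/(2τ(t))}/√(1 − e^{−2λt}) ≤ ∫_{τ(t)}^∞ (x/√(2πs³))·e^{−x²/(2s)} ds ≤ √(4λ/π)·x·e^{−λt}/√(1 − e^{−2λt}). -/
open MeasureTheory

theorem ou_aux_const (lam x t : ℝ) (hlam : 0 < lam) (ht : 0 < t) :
    Real.sqrt (4 * lam / Real.pi) * x * Real.exp (-lam * t) /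
        Real.sqrt (1 - Real.exp (-2 * lam * t)) =
    x / Real.sqrt (2 * Real.pi) *
      (2 / Real.sqrt ((Real.exp (2 * lam * t) - 1) / (2 * lam))) := by
  have hpi := Real.pi_pos
  have hE : 1 < Real.exp (2 * lam * t) := Real.one_lt_exp_iff.2 (by positivity)
  have hE0 : 0 < Real.exp (2 * lam * t) - 1 := by linarith
  have h1 : Real.exp (-lam * t) = Real.sqrt (Real.exp (-2 * lam * t)) := by
    rw [← Real.exp_half]; congr 1; ring
  have h2 : (2 : ℝ) = Real.sqrt 4 := by
    rw [show (4 : ℝ) = 2 ^ 2 by norm_num, Real.sqrt_sq (by norm_num)]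
  have h3 : 1 - Real.exp (-2 * lam * t) =
      (Real.exp (2 * lam * t) - 1) * Real.exp (-2 * lam * t) := by
    rw [sub_mul, ← Real.exp_add, show 2 * lam * t + -2 * lam * t = 0 by ring, Real.exp_zero, one_mul]
  have key : Real.sqrt (4 * lam / Real.pi) * Real.exp (-lam * t) /
        Real.sqrt (1 - Real.exp (-2 * lam * t)) =
      2 / (Real.sqrt (2 * Real.pi) *
        Real.sqrt ((Real.exp (2 * lam * t) - 1) / (2 * lam))) := by
    have hF := Real.exp_pos (-2 * lam * t)
    rw [h1, h3, ← Real.sqrt_mul (by positivity), ← Real.sqrt_div (by positivity),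
      ← Real.sqrt_mul (by positivity)]
    nth_rewrite 4 [h2]
    rw [← Real.sqrt_div (by norm_num)]
    congr 1
    field_simp
  calc _ = x * (Real.sqrt (4 * lam / Real.pi) * Real.exp (-lam * t) /
        Real.sqrt (1 - Real.exp (-2 * lam * t))) := by ring
    _ = _ := by rw [key]; field_simp

theorem ou_aux_bounds (x T : ℝ) (hx : 0 < x) (hT : 0 < T) :
    x / Real.sqrt (2 * Real.pi) * (2 / Real.sqrt T) * Real.exp (-x ^ 2 / (2 * T)) ≤
      (∫ s in Set.Ioi T, x / Real.sqrt (2 * Real.pi * s ^ 3) * Real.exp (-x ^ 2 / (2 * s))) ∧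
    (∫ s in Set.Ioi T, x / Real.sqrt (2 * Real.pi * s ^ 3) * Real.exp (-x ^ 2 / (2 * s))) ≤
      x / Real.sqrt (2 * Real.pi) * (2 / Real.sqrt T) := by
  have hpi := Real.pi_pos
  have hI : IntegrableOn (fun s : ℝ => x / Real.sqrt (2 * Real.pi) * s ^ (-(3 / 2) : ℝ))
      (Set.Ioi T) :=
    (integrableOn_Ioi_rpow_of_lt (by norm_num) hT).const_mul _
  have hV : ∫ s in Set.Ioi T, x / Real.sqrt (2 * Real.pi) * s ^ (-(3 / 2) : ℝ) =
      x / Real.sqrt (2 * Real.pi) * (2 / Real.sqrt T) := by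
    rw [integral_const_mul, integral_Ioi_rpow_of_lt (by norm_num) hT,
      show (-(3 / 2) + 1 : ℝ) = -(1 / 2) by norm_num, Real.rpow_neg hT.le, ← Real.sqrt_eq_rpow]
    congr 1
    have := Real.sqrt_pos.2 hT
    field_simp
  have hpt : ∀ s ∈ Set.Ioi T, x / Real.sqrt (2 * Real.pi * s ^ 3) =
      x / Real.sqrt (2 * Real.pi) * s ^ (-(3 / 2) : ℝ) := by
    intro s hs
    have hs0 : 0 < s := hT.trans hs
    rw [Real.sqrt_mul (by positivity), Real.rpow_neg hs0.le, Real.sqrt_eq_rpow (s ^ 3),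
      ← Real.rpow_natCast s 3, ← Real.rpow_mul hs0.le]
    norm_num
    field_simp
  have hle : ∀ s ∈ Set.Ioi T, Real.exp (-x ^ 2 / (2 * s)) ≤ 1 := by
    intro s hs
    have hs0 : 0 < s := hT.trans hs
    rw [Real.exp_le_one_iff, neg_div]
    have : 0 ≤ x ^ 2 / (2 * s) := by positivity
    linarith
  have hge : ∀ s ∈ Set.Ioi T, Real.exp (-x ^ 2 / (2 * T)) ≤ Real.exp (-x ^ 2 / (2 * s)) := by
    intro s hs
    have hs' : T < s := hs
    rw [Real.exp_le_exp, neg_div, neg_div, neg_le_neg_iff]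
    gcongr
  have hupper : ∀ s ∈ Set.Ioi T,
      x / Real.sqrt (2 * Real.pi * s ^ 3) * Real.exp (-x ^ 2 / (2 * s)) ≤
      x / Real.sqrt (2 * Real.pi) * s ^ (-(3 / 2) : ℝ) := by
    intro s hs
    rw [← hpt s hs]
    exact mul_le_of_le_one_right (by positivity) (hle s hs)
  have hJ : IntegrableOn (fun s : ℝ =>
      x / Real.sqrt (2 * Real.pi * s ^ 3) * Real.exp (-x ^ 2 / (2 * s))) (Set.Ioi T) := by
    refine Integrable.mono' hI (Measurable.aestronglyMeasurable (by fun_prop)) ?_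
    refine (ae_restrict_iff' measurableSet_Ioi).2 (Filter.Eventually.of_forall fun s hs => ?_)
    rw [Real.norm_of_nonneg (by positivity)]
    exact hupper s hs
  constructor
  · rw [← hV, ← integral_mul_const]
    refine setIntegral_mono_on (hI.mul_const _) hJ measurableSet_Ioi fun s hs => ?_
    rw [← hpt s hs]
    exact mul_le_mul_of_nonneg_left (hge s hs) (by positivity)
  · rw [← hV]
    exact setIntegral_mono_on hJ hI measurableSet_Ioi hupper

/-- Two-sided bound for the survival probability of the Ornstein–Uhlenbeck process killed
at `0`: with `τ(t) = (e^{2λt} − 1)/(2λ)`, for all `x > 0` and `t > 0`,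
`√(4λ/π)·x·e^{−λt}·e^{−x²/(2τ(t))}/√(1−e^{−2λt}) ≤ ∫_{τ(t)}^∞ (x/√(2πs³)) e^{−x²/(2s)} ds
≤ √(4λ/π)·x·e^{−λt}/√(1−e^{−2λt})`. -/
theorem ou_survival_probability_bounds (lam : ℝ) (hlam : 0 < lam)
    (x t : ℝ) (hx : 0 < x) (ht : 0 < t) :
    Real.sqrt (4 * lam / Real.pi) * x * Real.exp (-lam * t) *
        Real.exp (-x ^ 2 / (2 * ((Real.exp (2 * lam * t) - 1) / (2 * lam)))) /
        Real.sqrt (1 - Real.exp (-2 * lam * t)) ≤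
      (∫ s in Set.Ioi ((Real.exp (2 * lam * t) - 1) / (2 * lam)),
        x / Real.sqrt (2 * Real.pi * s ^ 3) * Real.exp (-x ^ 2 / (2 * s))) ∧
    (∫ s in Set.Ioi ((Real.exp (2 * lam * t) - 1) / (2 * lam)),
        x / Real.sqrt (2 * Real.pi * s ^ 3) * Real.exp (-x ^ 2 / (2 * s))) ≤
      Real.sqrt (4 * lam / Real.pi) * x * Real.exp (-lam * t) /
        Real.sqrt (1 - Real.exp (-2 * lam * t)) := by
  have hE : 1 < Real.exp (2 * lam * t) := Real.one_lt_exp_iff.2 (by positivity)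
  have hT : 0 < (Real.exp (2 * lam * t) - 1) / (2 * lam) :=
    div_pos (by linarith) (by positivity)
  have h := ou_aux_bounds x _ hx hT
  rw [← ou_aux_const lam x t hlam ht] at h
  refine ⟨le_trans (le_of_eq ?_) h.1, h.2⟩
  ring
end

section
/- Fix c > 0 and x > 0, set λ := c²/2, and for s > 0 define E(s) := (e^{cx}·e^{−λs} / (2πλ²·√(2πs))) · ∫₀^∞ y²·e^{cy}·( e^{−(x−y)²/(2s)} − e^{−(x+y)²/(2s)} ) dy. Then for every β > 0, the integral ∫₀^∞ E(s)·e^{(c² − β)s} ds is finite if and only if β > c². -/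
open MeasureTheory

namespace BMaux

/-- inner integrand -/
noncomputable def G (c x s y : ℝ) : ℝ := y ^ 2 * Real.exp (c * y) *
            (Real.exp (-(x - y) ^ 2 / (2 * s)) - Real.exp (-(x + y) ^ 2 / (2 * s)))

lemma G_eq (c x s y : ℝ) (hs : 0 < s) : G c x s y =
    y ^ 2 * (Real.exp (c * x + c ^ 2 / 2 * s) * Real.exp (-(y - (x + c * s)) ^ 2 / (2 * s))) *
      (1 - Real.exp (-(2 * x * y / s))) := by
  unfold G
  have h1 : Real.exp (-(x + y) ^ 2 / (2 * s))
      = Real.exp (-(x - y) ^ 2 / (2 * s)) * Real.exp (-(2 * x * y / s)) := by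
    rw [← Real.exp_add]; congr 1; field_simp; ring
  have h2 : Real.exp (c * x + c ^ 2 / 2 * s) * Real.exp (-(y - (x + c * s)) ^ 2 / (2 * s))
      = Real.exp (c * y) * Real.exp (-(x - y) ^ 2 / (2 * s)) := by
    rw [← Real.exp_add, ← Real.exp_add]; congr 1; field_simp; ring
  rw [h1, h2]; ring

lemma G_nonneg (c x s y : ℝ) (hx : 0 < x) (hs : 0 < s) (hy : 0 < y) : 0 ≤ G c x s y := by
  rw [G_eq c x s y hs]
  have : Real.exp (-(2 * x * y / s)) ≤ 1 := by
    rw [Real.exp_le_one_iff]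
    have : 0 < 2 * x * y / s := by positivity
    linarith
  have h2 : 0 ≤ 1 - Real.exp (-(2 * x * y / s)) := by linarith
  positivity

lemma G_le (c x s y : ℝ) (hs : 0 < s) :
    G c x s y ≤ Real.exp (c * x + c ^ 2 / 2 * s) * (2 * (x + c * s) ^ 2 + 8 * s) *
      Real.exp (-(1 / (4 * s)) * (y - (x + c * s)) ^ 2) := by
  rw [G_eq c x s y hs]
  set m := x + c * s
  set P := Real.exp (c * x + c ^ 2 / 2 * s)
  have hP : 0 < P := Real.exp_pos _
  set e := Real.exp (-(1 / (4 * s)) * (y - m) ^ 2) with he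
  have hee : Real.exp (-(y - m) ^ 2 / (2 * s)) = e * e := by
    rw [he, ← Real.exp_add]; congr 1; field_simp; ring
  rw [hee]
  have hpos : 0 < e := Real.exp_pos _
  have hle1 : e ≤ 1 := by
    rw [he, Real.exp_le_one_iff]
    have : 0 ≤ (1 / (4 * s)) * (y - m) ^ 2 := by positivity
    linarith
  have ht : (y - m) ^ 2 * e ≤ 4 * s := by
    have h1 := Real.add_one_le_exp ((1 / (4 * s)) * (y - m) ^ 2)
    have h2 : e * Real.exp ((1 / (4 * s)) * (y - m) ^ 2) = 1 := by
      rw [he, ← Real.exp_add]; simp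
    have h3 : (y - m) ^ 2 = 4 * s * ((1 / (4 * s)) * (y - m) ^ 2) := by field_simp
    have h4 : (1 / (4 * s)) * (y - m) ^ 2 * e ≤ 1 := by nlinarith
    rw [h3]; nlinarith
  have hy : y ^ 2 * e ≤ 2 * m ^ 2 + 8 * s := by
    have h1 : y ^ 2 ≤ 2 * m ^ 2 + 2 * (y - m) ^ 2 := by nlinarith [sq_nonneg (y - 2 * m)]
    have h2 : m ^ 2 * e ≤ m ^ 2 := mul_le_of_le_one_right (sq_nonneg m) hle1
    nlinarith [mul_le_mul_of_nonneg_right h1 hpos.le]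
  have hq : 1 - Real.exp (-(2 * x * y / s)) ≤ 1 := by linarith [Real.exp_pos (-(2 * x * y / s))]
  calc _ ≤ y ^ 2 * (P * (e * e)) * 1 := by
        apply mul_le_mul_of_nonneg_left hq; positivity
    _ = P * (y ^ 2 * e) * e := by ring
    _ ≤ _ := by gcongr

lemma gauss_int (s m : ℝ) (hs : 0 < s) :
    Integrable (fun y : ℝ => Real.exp (-(1 / (4 * s)) * (y - m) ^ 2)) :=
  (integrable_exp_neg_mul_sq (b := 1 / (4 * s)) (by positivity)).comp_sub_right m

lemma gauss_val (s m : ℝ) (hs : 0 < s) :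
    ∫ y : ℝ, Real.exp (-(1 / (4 * s)) * (y - m) ^ 2) = √2 * √(2 * Real.pi * s) := by
  rw [integral_sub_right_eq_self (fun y : ℝ => Real.exp (-(1 / (4 * s)) * y ^ 2)) m,
    integral_gaussian, ← Real.sqrt_mul (by norm_num)]
  congr 1; field_simp; norm_num

lemma G_cont (c x s : ℝ) : Continuous (G c x s) := by
  unfold G; fun_prop

lemma G_int (c x s : ℝ) (hx : 0 < x) (hs : 0 < s) :
    IntegrableOn (G c x s) (Set.Ioi 0) := by
  refine Integrable.mono' (((gauss_int s (x + c * s) hs).const_mul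
    (Real.exp (c * x + c ^ 2 / 2 * s) * (2 * (x + c * s) ^ 2 + 8 * s))).integrableOn)
    (G_cont c x s).aestronglyMeasurable ?_
  filter_upwards [ae_restrict_mem measurableSet_Ioi] with y hy
  rw [Real.norm_of_nonneg (G_nonneg c x s y hx hs hy)]
  exact G_le c x s y hs

lemma I_nonneg (c x s : ℝ) (hx : 0 < x) (hs : 0 < s) : 0 ≤ ∫ y in Set.Ioi (0:ℝ), G c x s y :=
  setIntegral_nonneg measurableSet_Ioi fun y hy => G_nonneg c x s y hx hs hy

lemma I_le (c x s : ℝ) (hx : 0 < x) (hs : 0 < s) : ∫ y in Set.Ioi (0:ℝ), G c x s y ≤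
    Real.exp (c * x + c ^ 2 / 2 * s) * (2 * (x + c * s) ^ 2 + 8 * s) *
      (√2 * √(2 * Real.pi * s)) := by
  have hi := (gauss_int s (x + c * s) hs).const_mul
    (Real.exp (c * x + c ^ 2 / 2 * s) * (2 * (x + c * s) ^ 2 + 8 * s))
  calc _ ≤ ∫ y in Set.Ioi (0:ℝ), Real.exp (c * x + c ^ 2 / 2 * s) * (2 * (x + c * s) ^ 2 + 8 * s) *
      Real.exp (-(1 / (4 * s)) * (y - (x + c * s)) ^ 2) :=
        setIntegral_mono_on (G_int c x s hx hs) hi.integrableOn measurableSet_Ioi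
          fun y _ => G_le c x s y hs
    _ ≤ ∫ y, Real.exp (c * x + c ^ 2 / 2 * s) * (2 * (x + c * s) ^ 2 + 8 * s) *
      Real.exp (-(1 / (4 * s)) * (y - (x + c * s)) ^ 2) :=
        setIntegral_le_integral hi (Filter.Eventually.of_forall fun y => by positivity)
    _ = _ := by rw [integral_const_mul, gauss_val s _ hs]

lemma I_ge (c x s : ℝ) (hc : 0 < c) (hx : 0 < x) (hs : 0 < s) :
    (c * s) ^ 2 * (Real.exp (c * x + c ^ 2 / 2 * s) * Real.exp (-(1 / 2))) *
      (1 - Real.exp (-(2 * x * c))) * √s ≤ ∫ y in Set.Ioi (0:ℝ), G c x s y := by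
  have hcs : 0 < c * s := by positivity
  have hsub : Set.Icc (x + c * s) (x + c * s + √s) ⊆ Set.Ioi 0 := fun y hy => by
    have := hy.1
    simp only [Set.mem_Ioi]; linarith
  have hδ : 0 ≤ 1 - Real.exp (-(2 * x * c)) := by
    have : Real.exp (-(2 * x * c)) ≤ 1 := by
      rw [Real.exp_le_one_iff]
      have : 0 < 2 * x * c := by positivity
      linarith
    linarith
  calc _ = ∫ y in Set.Icc (x + c * s) (x + c * s + √s), (c * s) ^ 2 *
        (Real.exp (c * x + c ^ 2 / 2 * s) * Real.exp (-(1 / 2))) *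
        (1 - Real.exp (-(2 * x * c))) := by
        rw [setIntegral_const]
        simp [Measure.real, Real.volume_Icc, ENNReal.toReal_ofReal (Real.sqrt_nonneg s)]
        ring
    _ ≤ ∫ y in Set.Icc (x + c * s) (x + c * s + √s), G c x s y := by
        refine setIntegral_mono_on (integrableOn_const (by simp))
          ((G_int c x s hx hs).mono_set hsub) measurableSet_Icc ?_
        intro y hy
        rw [G_eq c x s y hs]
        have hy1 := hy.1
        have hy2 := hy.2
        have hcy : c * s ≤ y := by linarith
        have h1 : (y - (x + c * s)) ^ 2 ≤ s := by
          have := Real.sq_sqrt hs.le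
          nlinarith [Real.sqrt_nonneg s]
        have h2 : Real.exp (-(1 / 2)) ≤ Real.exp (-(y - (x + c * s)) ^ 2 / (2 * s)) := by
          apply Real.exp_le_exp.mpr
          rw [le_div_iff₀ (by positivity)]
          linarith
        have h3 : Real.exp (-(2 * x * y / s)) ≤ Real.exp (-(2 * x * c)) := by
          apply Real.exp_le_exp.mpr
          apply neg_le_neg
          rw [le_div_iff₀ hs]
          nlinarith
        gcongr
    _ ≤ _ := by
        refine setIntegral_mono_set (G_int c x s hx hs) ?_ hsub.eventuallyLE
        filter_upwards [ae_restrict_mem measurableSet_Ioi] with y hy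
        exact G_nonneg c x s y hx hs hy

lemma poly_le (c x γ s : ℝ) (hγ : 0 < γ) (hs : 0 < s) :
    2 * (x + c * s) ^ 2 + 8 * s ≤
      (4 * x ^ 2 + 32 * c ^ 2 / γ ^ 2 + 16 / γ) * Real.exp (γ / 2 * s) := by
  have h := Real.quadratic_le_exp_of_nonneg (x := γ / 2 * s) (by positivity)
  have ht : 0 < γ / 2 * s := by positivity
  set E := Real.exp (γ / 2 * s)
  have h1 : x ^ 2 ≤ x ^ 2 * E := le_mul_of_one_le_right (sq_nonneg x) (by nlinarith)
  have h2 : 8 * s ≤ 16 / γ * E := by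
    have : 8 * s = 16 / γ * (γ / 2 * s) := by field_simp; norm_num
    rw [this]; gcongr; nlinarith
  have h3 : 4 * c ^ 2 * s ^ 2 ≤ 32 * c ^ 2 / γ ^ 2 * E := by
    have : 4 * c ^ 2 * s ^ 2 = 32 * c ^ 2 / γ ^ 2 * ((γ / 2 * s) ^ 2 / 2) := by
      field_simp; ring
    rw [this]; gcongr; nlinarith
  nlinarith [sq_nonneg (x - c * s)]

end BMaux



/-- For Brownian motion with drift `−c < 0` killed at the origin, with `λ = c²/2` and
`E(s)` the second moment `E_x(h²(X_s))` written out explicitly, for every `β > 0` the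
integral `∫₀^∞ E(s)·e^{(c² − β)s} ds` is finite if and only if `β > c²`. -/
theorem bm_killed_L2_convergence_criterion (c x : ℝ) (hc : 0 < c) (hx : 0 < x)
    (lam : ℝ) (hlam : lam = c ^ 2 / 2) (β : ℝ) (hβ : 0 < β) :
    IntegrableOn (fun s : ℝ =>
        (Real.exp (c * x) * Real.exp (-lam * s) /
            (2 * Real.pi * lam ^ 2 * Real.sqrt (2 * Real.pi * s)) *
          ∫ y in Set.Ioi (0:ℝ), y ^ 2 * Real.exp (c * y) *
            (Real.exp (-(x - y) ^ 2 / (2 * s)) - Real.exp (-(x + y) ^ 2 / (2 * s)))) *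
          Real.exp ((c ^ 2 - β) * s))
      (Set.Ioi 0) volume ↔ c ^ 2 < β := by
  have hlp : 0 < lam := by rw [hlam]; positivity
  have hpi := Real.pi_pos
  change IntegrableOn (fun s : ℝ => (Real.exp (c * x) * Real.exp (-lam * s) /
            (2 * Real.pi * lam ^ 2 * Real.sqrt (2 * Real.pi * s)) *
          ∫ y in Set.Ioi (0:ℝ), BMaux.G c x s y) *
          Real.exp ((c ^ 2 - β) * s)) (Set.Ioi 0) volume ↔ _
  constructor
  · intro h
    by_contra hcon
    push Not at hcon
    have h' := h.mono_set (Set.Ioi_subset_Ioi (zero_le_one : (0:ℝ) ≤ 1))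
    have hδ : 0 < 1 - Real.exp (-(2 * x * c)) := by
      have : Real.exp (-(2 * x * c)) < 1 := by
        rw [Real.exp_lt_one_iff]
        have : 0 < 2 * x * c := by positivity
        linarith
      linarith
    set K : ℝ := Real.exp (c * x) / (2 * Real.pi * lam ^ 2 * √(2 * Real.pi)) *
      (c ^ 2 * (Real.exp (c * x) * Real.exp (-(1 / 2))) * (1 - Real.exp (-(2 * x * c)))) with hK
    have hKpos : 0 < K := by positivity
    have hconst : IntegrableOn (fun _ : ℝ => K) (Set.Ioi 1) volume := by
      refine Integrable.mono' h' aestronglyMeasurable_const ?_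
      filter_upwards [ae_restrict_mem measurableSet_Ioi] with s hs
      have hs1 : 1 < s := hs
      have hs0 : 0 < s := by linarith
      rw [Real.norm_of_nonneg hKpos.le]
      have hI := BMaux.I_ge c x s hc hx hs0
      have hE : 1 ≤ Real.exp ((c ^ 2 - β) * s) := by
        rw [Real.one_le_exp_iff]
        exact mul_nonneg (by linarith) hs0.le
      have hsq : 0 < √s := Real.sqrt_pos.mpr hs0
      calc K ≤ K * s ^ 2 := le_mul_of_one_le_right hKpos.le (by nlinarith)
        _ = Real.exp (c * x) * Real.exp (-lam * s) /
            (2 * Real.pi * lam ^ 2 * Real.sqrt (2 * Real.pi * s)) *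
            ((c * s) ^ 2 * (Real.exp (c * x + c ^ 2 / 2 * s) * Real.exp (-(1 / 2))) *
      (1 - Real.exp (-(2 * x * c))) * √s) := by
            rw [Real.sqrt_mul (by positivity) s, Real.exp_add, ← hlam, neg_mul,
              Real.exp_neg (lam * s), hK]
            have : Real.exp (lam * s) ≠ 0 := (Real.exp_pos _).ne'
            field_simp
        _ ≤ Real.exp (c * x) * Real.exp (-lam * s) /
            (2 * Real.pi * lam ^ 2 * Real.sqrt (2 * Real.pi * s)) *
            ∫ y in Set.Ioi (0:ℝ), BMaux.G c x s y := by gcongr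
        _ ≤ _ := by
            refine le_mul_of_one_le_right (mul_nonneg (by positivity) ?_) hE
            exact BMaux.I_nonneg c x s hx hs0
    rw [integrableOn_const_iff] at hconst
    rcases hconst with h0 | h0
    · exact hKpos.ne' (by simpa using h0)
    · simp at h0
  · intro hlt
    set γ := β - c ^ 2 with hγ
    have hγp : 0 < γ := by linarith
    set D : ℝ := Real.exp (c * x) / (2 * Real.pi * lam ^ 2) * (Real.exp (c * x) * √2) *
      (4 * x ^ 2 + 32 * c ^ 2 / γ ^ 2 + 16 / γ) with hD
    refine Integrable.mono' ((exp_neg_integrableOn_Ioi 0 (half_pos hγp)).const_mul D) ?_ ?_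
    · have hm : StronglyMeasurable fun s : ℝ => ∫ y in Set.Ioi (0:ℝ), BMaux.G c x s y := by
        apply StronglyMeasurable.integral_prod_right (f := fun s y => BMaux.G c x s y)
        apply Measurable.stronglyMeasurable
        simp only [Function.uncurry_def, BMaux.G]
        fun_prop
      have h1 : Measurable fun s : ℝ => Real.exp (c * x) * Real.exp (-lam * s) /
            (2 * Real.pi * lam ^ 2 * Real.sqrt (2 * Real.pi * s)) := by fun_prop
      have h2 : Measurable fun s : ℝ => Real.exp ((c ^ 2 - β) * s) := by fun_prop
      exact ((h1.mul hm.measurable).mul h2).aestronglyMeasurable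
    · filter_upwards [ae_restrict_mem measurableSet_Ioi] with s hs
      have hs0 : 0 < s := hs
      have hIn := BMaux.I_nonneg c x s hx hs0
      have hI := BMaux.I_le c x s hx hs0
      have hp := BMaux.poly_le c x γ s hγp hs0
      rw [Real.norm_of_nonneg (mul_nonneg (mul_nonneg (by positivity) hIn) (Real.exp_pos _).le)]
      calc _ ≤ Real.exp (c * x) * Real.exp (-lam * s) /
            (2 * Real.pi * lam ^ 2 * Real.sqrt (2 * Real.pi * s)) *
            (Real.exp (c * x + c ^ 2 / 2 * s) *
             ((4 * x ^ 2 + 32 * c ^ 2 / γ ^ 2 + 16 / γ) * Real.exp (γ / 2 * s)) *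
              (√2 * √(2 * Real.pi * s))) * Real.exp ((c ^ 2 - β) * s) := by
            gcongr
            exact hI.trans (by gcongr)
        _ = D * Real.exp (-(γ / 2) * s) := by
            have e1 : (c ^ 2 - β) * s = -(γ / 2 * s) + -(γ / 2 * s) := by rw [hγ]; ring
            have hq : 0 < √(2 * Real.pi * s) := by positivity
            rw [e1, Real.exp_add (-(γ / 2 * s)), Real.exp_add (c * x), ← hlam, neg_mul, neg_mul,
              Real.exp_neg (lam * s), Real.exp_neg (γ / 2 * s), hD]
            have : Real.exp (lam * s) ≠ 0 := (Real.exp_pos _).ne'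
            have : Real.exp (γ / 2 * s) ≠ 0 := (Real.exp_pos _).ne'
            generalize (4 * x ^ 2 + 32 * c ^ 2 / γ ^ 2 + 16 / γ) = Q
            field_simp
end
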